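/- arXiv:2508.01404 — 9 statements merged into one kernel-verified Lean document; each statement's English description precedes it below -/
import Mathlib

section
/- Let a simple hexagon (encoded as in the context) satisfy ℓ₀ = ℓ₃, ℓ₁ = ℓ₅ and ℓ₂ = ℓ₄, and suppose that edges 0 and 3 are parallel as opposite sides. Then A₀ + A₂ + A₄ = 2π or A₂ + A₅ = 2π. -/
/-- The direction angle of edge `k`: `φₖ = k·π − (A₁ + ⋯ + Aₖ)` (so `φ₀ = 0`). -/
noncomputable def hexPhi (A : Fin 6 → ℝ) (k : Fin 6) : ℝ :=
  (k : ℕ) * Real.pi -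
    ∑ j ∈ Finset.univ.filter (fun j : Fin 6 => 1 ≤ (j : ℕ) ∧ (j : ℕ) ≤ (k : ℕ)), A j

/-- The closure equation `∑ₖ ℓₖ·exp(I·φₖ) = 0`. -/
def HexClosure (ℓ A : Fin 6 → ℝ) : Prop :=
  ∑ k : Fin 6, (ℓ k : ℂ) * Complex.exp (Complex.I * (hexPhi A k : ℂ)) = 0

/-- The vertices `P_m = ∑_{k<m} ℓₖ·exp(I·φₖ)`. -/
noncomputable def hexVertex (ℓ A : Fin 6 → ℝ) (m : Fin 6) : ℂ :=
  ∑ k ∈ Finset.univ.filter (fun k : Fin 6 => (k : ℕ) < (m : ℕ)),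
    (ℓ k : ℂ) * Complex.exp (Complex.I * (hexPhi A k : ℂ))

/-- Edge `k`: the closed segment from `P_k` to `P_{k+1}` (indices mod 6). -/
noncomputable def hexEdge (ℓ A : Fin 6 → ℝ) (k : Fin 6) : Set ℂ :=
  segment ℝ (hexVertex ℓ A k) (hexVertex ℓ A (k + 1))

/-- Simplicity: non-adjacent edges are disjoint, and adjacent edges meet only in
their common endpoint. -/
def HexSimple (ℓ A : Fin 6 → ℝ) : Prop :=
  (∀ j k : Fin 6, j ≠ k → k ≠ j + 1 → j ≠ k + 1 →
    Disjoint (hexEdge ℓ A j) (hexEdge ℓ A k)) ∧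
  (∀ k : Fin 6, hexEdge ℓ A k ∩ hexEdge ℓ A (k + 1) = {hexVertex ℓ A (k + 1)})

/-- Edges `k` and `k+3` are parallel as opposite sides: `exp(I·φₖ) = −exp(I·φ_{k+3})`. -/
def HexParallelOpp (A : Fin 6 → ℝ) (k : Fin 6) : Prop :=
  Complex.exp (Complex.I * (hexPhi A k : ℂ)) =
    - Complex.exp (Complex.I * (hexPhi A (k + 3) : ℂ))


theorem Complex.exp_I_mul_ofReal_eq (x : ℝ) :
    Complex.exp (Complex.I * (x : ℂ)) = ⟨Real.cos x, Real.sin x⟩ := by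
  rw [mul_comm]
  apply Complex.ext
  · simp [Complex.exp_ofReal_mul_I_re]
  · simp [Complex.exp_ofReal_mul_I_im]

theorem hexPhi_sub_succ (A : Fin 6 → ℝ) :
    hexPhi A 1 - hexPhi A 2 = A 2 - Real.pi ∧ hexPhi A 4 - hexPhi A 5 = A 5 - Real.pi ∧
      hexPhi A 0 = 0 ∧ hexPhi A 3 = 3 * Real.pi - (A 1 + A 2 + A 3) := by
  simp only [hexPhi, Finset.sum_filter, Fin.sum_univ_six]
  refine ⟨?_, ?_, ?_, ?_⟩ <;> norm_num <;> ring

/-- The triangles on edges `1, 2` and on edges `4, 5` have equal third sides, so the law of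
cosines compares the angles between their other two sides. -/
theorem cos_sub_eq_cos_sub_of_closed {a b p q r s : ℝ} (ha : 0 < a) (hb : 0 < b)
    (hcos : a * Real.cos p + b * Real.cos q + b * Real.cos r + a * Real.cos s = 0)
    (hsin : a * Real.sin p + b * Real.sin q + b * Real.sin r + a * Real.sin s = 0) :
    Real.cos (p - q) = Real.cos (r - s) := by
  rw [Real.cos_sub, Real.cos_sub]
  refine mul_left_cancel₀ (mul_pos (mul_pos two_pos ha) hb).ne' ?_
  linear_combination
    (a * Real.cos p + b * Real.cos q - b * Real.cos r - a * Real.cos s) * hcos +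
    (a * Real.sin p + b * Real.sin q - b * Real.sin r - a * Real.sin s) * hsin -
    a ^ 2 * Real.sin_sq_add_cos_sq p - b ^ 2 * Real.sin_sq_add_cos_sq q +
    b ^ 2 * Real.sin_sq_add_cos_sq r + a ^ 2 * Real.sin_sq_add_cos_sq s

theorem eq_or_add_eq_two_pi_of_cos_eq {x y : ℝ} (hx : 0 < x) (hx' : x < 2 * Real.pi)
    (hy : 0 < y) (hy' : y < 2 * Real.pi) (h : Real.cos x = Real.cos y) :
    x = y ∨ x + y = 2 * Real.pi := by
  have hpi := Real.pi_pos
  obtain ⟨k, hk | hk⟩ := Real.cos_eq_cos_iff.1 h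
  · have h₁ : (-1 : ℝ) < k := by nlinarith
    have h₂ : (k : ℝ) < 1 := by nlinarith
    have h₀ : k = 0 := by
      have : -1 < k := by exact_mod_cast h₁
      have : k < 1 := by exact_mod_cast h₂
      lia
    left
    simp [h₀] at hk
    exact hk.symm
  · have h₁ : (0 : ℝ) < k := by nlinarith
    have h₂ : (k : ℝ) < 2 := by nlinarith
    have h₀ : k = 1 := by
      have : 0 < k := by exact_mod_cast h₁
      have : k < 2 := by exact_mod_cast h₂
      lia
    right
    simp [h₀] at hk
    linarith

theorem stmt5 (ℓ A : Fin 6 → ℝ)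
    (hlen : ∀ k, 0 < ℓ k)
    (hang_pos : ∀ i, 0 < A i) (hang_lt : ∀ i, A i < 2 * Real.pi)
    (hang_sum : A 0 + A 1 + A 2 + A 3 + A 4 + A 5 = 4 * Real.pi)
    (hclose : HexClosure ℓ A)
    (hsimple : HexSimple ℓ A)
    (h03 : ℓ 0 = ℓ 3) (h15 : ℓ 1 = ℓ 5) (h24 : ℓ 2 = ℓ 4)
    (hpar : HexParallelOpp A 0) :
    A 0 + A 2 + A 4 = 2 * Real.pi ∨ A 2 + A 5 = 2 * Real.pi := by
  obtain ⟨h12, h45, hφ0, hφ3⟩ := hexPhi_sub_succ A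
  rw [HexParallelOpp, zero_add, Complex.exp_I_mul_ofReal_eq, Complex.exp_I_mul_ofReal_eq] at hpar
  have hparc : Real.cos (hexPhi A 0) = -Real.cos (hexPhi A 3) := congrArg Complex.re hpar
  have hpars : Real.sin (hexPhi A 0) = -Real.sin (hexPhi A 3) := congrArg Complex.im hpar
  simp only [HexClosure, Complex.exp_I_mul_ofReal_eq, Fin.sum_univ_six] at hclose
  have hre := congrArg Complex.re hclose
  have him := congrArg Complex.im hclose
  simp only [Complex.add_re, Complex.add_im, Complex.re_ofReal_mul, Complex.im_ofReal_mul,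
    Complex.zero_re, Complex.zero_im, ← h03, ← h15, ← h24, hparc, hpars] at hre him
  have hcos : Real.cos (A 2) = Real.cos (A 5) := by
    have h := cos_sub_eq_cos_sub_of_closed (hlen 1) (hlen 2)
      (by linarith : _ = (0 : ℝ)) (by linarith : _ = (0 : ℝ))
      (p := hexPhi A 1) (q := hexPhi A 2) (r := hexPhi A 4) (s := hexPhi A 5)
    rw [h12, h45, Real.cos_sub_pi, Real.cos_sub_pi] at h
    exact neg_injective h
  have hsum : A 1 + A 2 + A 3 = 2 * Real.pi := by
    have h : Real.cos (A 1 + A 2 + A 3) = 1 := by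
      have e : 3 * Real.pi - (A 1 + A 2 + A 3) =
        Real.pi - (A 1 + A 2 + A 3) + 2 * Real.pi := by ring
      rw [hφ0, hφ3, Real.cos_zero, e, Real.cos_add_two_pi, Real.cos_pi_sub, neg_neg] at hparc
      exact hparc.symm
    obtain ⟨k, hk⟩ := (Real.cos_eq_one_iff _).1 h
    have hpi := Real.pi_pos
    have h₁ : (0 : ℝ) < k := by nlinarith [hang_pos 1, hang_pos 2, hang_pos 3]
    have h₂ : (k : ℝ) < 2 := by nlinarith [hang_pos 0, hang_pos 4, hang_pos 5]
    have h₀ : k = 1 := by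
      have : 0 < k := by exact_mod_cast h₁
      have : k < 2 := by exact_mod_cast h₂
      lia
    simpa [h₀] using hk.symm
  rcases eq_or_add_eq_two_pi_of_cos_eq (hang_pos 2) (hang_lt 2) (hang_pos 5) (hang_lt 5) hcos
    with h | h
  · left
    linarith
  · exact Or.inr h
end

section
/- Let a simple hexagon (encoded as in the context) satisfy ℓ₀ = ℓ₁, ℓ₃ = ℓ₄, A₀ = A₂, A₃ = A₅, and A₀ + A₁ + A₂ = 2π (equivalently, by the angle sum, A₃ + A₄ + A₅ = 2π). Then ℓ₂ = ℓ₅ and edges 2 and 5 are parallel as opposite sides; in particular the hexagon is a type-1 Reinhardt hexagon. -/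
/-- A type-1 Reinhardt hexagon: after a cyclic relabeling,
`Aᵢ + Aᵢ₊₁ + Aᵢ₊₂ = 2π` and `ℓᵢ₊₂ = ℓᵢ₊₅`. -/
def IsType1Reinhardt (ℓ A : Fin 6 → ℝ) : Prop :=
  ∃ i : Fin 6, A i + A (i + 1) + A (i + 2) = 2 * Real.pi ∧ ℓ (i + 2) = ℓ (i + 5)

/-- The real and imaginary parts of the closure equation, summed over the edges. -/
theorem HexClosure.sum_cos_sin {ℓ A : Fin 6 → ℝ} (h : HexClosure ℓ A) :
    ∑ k : Fin 6, ℓ k * Real.cos (hexPhi A k) = 0 ∧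
      ∑ k : Fin 6, ℓ k * Real.sin (hexPhi A k) = 0 := by
  unfold HexClosure at h
  simp only [mul_comm Complex.I] at h
  have hre := congrArg Complex.re h
  have him := congrArg Complex.im h
  simp only [Complex.re_sum, Complex.im_sum, Complex.re_ofReal_mul, Complex.im_ofReal_mul,
    Complex.exp_ofReal_mul_I_re, Complex.exp_ofReal_mul_I_im, Complex.zero_re,
    Complex.zero_im] at hre him
  exact ⟨hre, him⟩

theorem stmt7 (ℓ A : Fin 6 → ℝ)
    (hlen : ∀ k, 0 < ℓ k)
    (hang_pos : ∀ i, 0 < A i) (hang_lt : ∀ i, A i < 2 * Real.pi)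
    (hang_sum : A 0 + A 1 + A 2 + A 3 + A 4 + A 5 = 4 * Real.pi)
    (hclose : HexClosure ℓ A)
    (hsimple : HexSimple ℓ A)
    (h01 : ℓ 0 = ℓ 1) (h34 : ℓ 3 = ℓ 4)
    (hA02 : A 0 = A 2) (hA35 : A 3 = A 5)
    (h012 : A 0 + A 1 + A 2 = 2 * Real.pi) :
    ℓ 2 = ℓ 5 ∧ HexParallelOpp A 2 ∧ IsType1Reinhardt ℓ A := by
  have hA1 : A 1 = 2 * Real.pi - 2 * A 0 := by linarith
  have hA4 : A 4 = 2 * Real.pi - 2 * A 3 := by linarith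
  have p0 : hexPhi A 0 = 0 := by
    simp [hexPhi, Finset.sum_filter, Fin.sum_univ_six]
  have p1 : hexPhi A 1 = 2 * A 0 - Real.pi := by
    simp [hexPhi, Finset.sum_filter, Fin.sum_univ_six]
    linarith
  have p2 : hexPhi A 2 = A 0 := by
    simp [hexPhi, Finset.sum_filter, Fin.sum_univ_six]
    linarith
  have p3 : hexPhi A 3 = A 0 - A 3 + Real.pi := by
    simp [hexPhi, Finset.sum_filter, Fin.sum_univ_six]
    linarith
  have p4 : hexPhi A 4 = A 0 + A 3 := by
    simp [hexPhi, Finset.sum_filter, Fin.sum_univ_six]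
    linarith
  have p5 : hexPhi A 5 = A 0 + Real.pi := by
    simp [hexPhi, Finset.sum_filter, Fin.sum_univ_six]
    linarith
  have hl : ℓ 2 = ℓ 5 := by
    obtain ⟨hc, hs⟩ := hclose.sum_cos_sin
    simp only [Fin.sum_univ_six, p0, p1, p2, p3, p4, p5, Real.cos_zero, Real.sin_zero,
      Real.cos_pi, Real.sin_pi, Real.cos_two_mul,
      Real.sin_two_mul, Real.cos_sub, Real.sin_sub, Real.cos_add, Real.sin_add,
      ← h01, ← h34] at hc hs
    linear_combination Real.cos (A 0) * hc + Real.sin (A 0) * hs +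
      (2 * ℓ 0 * Real.cos (A 0) - (ℓ 2 - ℓ 5)) * Real.sin_sq_add_cos_sq (A 0)
  refine ⟨hl, ?_, 0, h012, hl⟩
  have p5' : hexPhi A (2 + 3) = A 0 + Real.pi := p5
  rw [HexParallelOpp, p2, p5', Complex.ofReal_add, mul_add, Complex.exp_add,
    mul_comm Complex.I (Real.pi : ℂ), Complex.exp_pi_mul_I]
  ring
end

section
/- Let a simple hexagon (encoded as in the context) satisfy ℓ₀ = ℓ₁ = ℓ₅, ℓ₂ = ℓ₃ = ℓ₄, A₀ = A₃, A₁ = A₄ and A₀ + A₃ + A₄ = 2π. Then ℓ₀ = ℓ₂ (so the hexagon is equilateral), A₂ = A₅, and A₀ + A₁ + A₂ = 2π. -/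
theorem one_sub_sub_sq_ne_zero_of_norm_eq_one {u : ℂ} (hu : ‖u‖ = 1) : 1 - u - u ^ 2 ≠ 0 := by
  intro h
  have hre := congrArg Complex.re h
  have him := congrArg Complex.im h
  have hn : u.re * u.re + u.im * u.im = 1 := by
    rw [← Complex.normSq_apply, Complex.normSq_eq_norm_sq, hu, one_pow]
  simp [sq] at hre him
  have hprod : u.im * (1 + 2 * u.re) = 0 := by linarith
  rcases mul_eq_zero.mp hprod with h0 | h0
  · rw [h0] at hn hre
    nlinarith
  · have hp : u.re = -1 / 2 := by linarith
    rw [hp] at hn hre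
    linarith

theorem eq_and_exp_eq_one_of_ofReal_eq_mul_exp {x y t : ℝ} (hx : 0 < x) (hy : 0 < y)
    (h : (x : ℂ) = y * Complex.exp (t * Complex.I)) :
    x = y ∧ Complex.exp (t * Complex.I) = 1 := by
  have hxy : x = y := by
    have := congrArg norm h
    rwa [norm_mul, Complex.norm_exp_ofReal_mul_I, mul_one, Complex.norm_of_nonneg hx.le,
      Complex.norm_of_nonneg hy.le] at this
  refine ⟨hxy, ?_⟩
  subst hxy
  have hx0 : (x : ℂ) ≠ 0 := by exact_mod_cast hx.ne'
  exact (mul_eq_left₀ hx0).mp h.symm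

theorem stmt9 (ℓ A : Fin 6 → ℝ)
    (hlen : ∀ k, 0 < ℓ k)
    (hang_pos : ∀ i, 0 < A i) (hang_lt : ∀ i, A i < 2 * Real.pi)
    (hang_sum : A 0 + A 1 + A 2 + A 3 + A 4 + A 5 = 4 * Real.pi)
    (hclose : HexClosure ℓ A)
    (hsimple : HexSimple ℓ A)
    (h01 : ℓ 0 = ℓ 1) (h05 : ℓ 0 = ℓ 5) (h23 : ℓ 2 = ℓ 3) (h24 : ℓ 2 = ℓ 4)
    (hA03 : A 0 = A 3) (hA14 : A 1 = A 4)
    (h034 : A 0 + A 3 + A 4 = 2 * Real.pi) :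
    ℓ 0 = ℓ 2 ∧ A 2 = A 5 ∧ A 0 + A 1 + A 2 = 2 * Real.pi := by
  have hb : A 1 = 2 * Real.pi - 2 * A 0 := by linarith
  have hd : A 5 = 2 * A 0 - A 2 := by linarith
  have hφ0 : hexPhi A 0 = 0 := by simp [hexPhi, Finset.sum_filter, Fin.sum_univ_six]
  have hφ1 : hexPhi A 1 = 2 * A 0 - Real.pi := by
    simp [hexPhi, Finset.sum_filter, Fin.sum_univ_six]; linarith
  have hφ2 : hexPhi A 2 = 2 * A 0 - A 2 := by
    simp [hexPhi, Finset.sum_filter, Fin.sum_univ_six]; linarith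
  have hφ3 : hexPhi A 3 = A 0 - A 2 + Real.pi := by
    simp [hexPhi, Finset.sum_filter, Fin.sum_univ_six]; linarith
  have hφ4 : hexPhi A 4 = 3 * A 0 - A 2 := by
    simp [hexPhi, Finset.sum_filter, Fin.sum_univ_six]; linarith
  have hφ5 : hexPhi A 5 = A 0 + Real.pi := by
    simp [hexPhi, Finset.sum_filter, Fin.sum_univ_six]; linarith
  set u : ℂ := Complex.exp (A 0 * Complex.I) with hu
  set v : ℂ := Complex.exp ((A 0 - A 2 : ℝ) * Complex.I) with hv
  have he1 : Complex.exp (Complex.I * (2 * A 0 - Real.pi : ℝ)) = -u ^ 2 := by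
    rw [hu, ← Complex.exp_nat_mul, ← Complex.exp_sub_pi_mul_I]
    push_cast; ring_nf
  have he2 : Complex.exp (Complex.I * (2 * A 0 - A 2 : ℝ)) = u * v := by
    rw [hu, hv, ← Complex.exp_add]
    push_cast; ring_nf
  have he3 : Complex.exp (Complex.I * (A 0 - A 2 + Real.pi : ℝ)) = -v := by
    rw [hv, ← Complex.exp_add_pi_mul_I]
    push_cast; ring_nf
  have he4 : Complex.exp (Complex.I * (3 * A 0 - A 2 : ℝ)) = u ^ 2 * v := by
    rw [hu, hv, ← Complex.exp_nat_mul, ← Complex.exp_add]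
    push_cast; ring_nf
  have he5 : Complex.exp (Complex.I * (A 0 + Real.pi : ℝ)) = -u := by
    rw [hu, ← Complex.exp_add_pi_mul_I]
    push_cast; ring_nf
  have hfactor : (1 - u - u ^ 2) * (ℓ 0 - ℓ 2 * v) = 0 := by
    unfold HexClosure at hclose
    rw [Fin.sum_univ_six, hφ0, hφ1, hφ2, hφ3, hφ4, hφ5, he1, he2, he3, he4, he5,
      ← h01, ← h05, ← h23, ← h24, Complex.ofReal_zero, mul_zero, Complex.exp_zero] at hclose
    linear_combination hclose
  have hmul : (ℓ 0 : ℂ) = ℓ 2 * v := sub_eq_zero.mp <|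
    (mul_eq_zero.mp hfactor).resolve_left <|
      one_sub_sub_sq_ne_zero_of_norm_eq_one (Complex.norm_exp_ofReal_mul_I _)
  obtain ⟨hlen_eq, hv1⟩ := eq_and_exp_eq_one_of_ofReal_eq_mul_exp (hlen 0) (hlen 2) hmul
  have hcos : Real.cos (A 0 - A 2) = 1 := by
    rw [← Complex.exp_ofReal_mul_I_re, hv1, Complex.one_re]
  have h1 := hang_pos 1
  have h0 := hang_pos 0
  have h2 := hang_pos 2
  have h2' := hang_lt 2
  have hac : A 0 - A 2 = 0 :=
    (Real.cos_eq_one_iff_of_lt_of_lt (by linarith) (by linarith)).mp hcos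
  exact ⟨hlen_eq, by linarith, by linarith⟩
end

section
/- Let a hexagon (encoded as in the context) satisfy ℓ₀ = ℓ₁ = ℓ₂ = ℓ₄ = ℓ₅, A₂ = A₄, A₃ = A₅, A₀ + A₂ + A₄ = 2π and A₁ + A₃ + A₅ = 2π. Then A₂ = A₃; consequently A₂ = A₃ = A₄ = A₅ and A₀ = A₁. -/
/-- The closure equation, rotated by an angle `θ` and projected to the imaginary axis. -/
theorem HexClosure.sum_mul_sin_add {ℓ A : Fin 6 → ℝ} (h : HexClosure ℓ A) (θ : ℝ) :
    ∑ k : Fin 6, ℓ k * Real.sin (hexPhi A k + θ) = 0 := by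
  have hmul : (∑ k : Fin 6, (ℓ k : ℂ) * Complex.exp (Complex.I * (hexPhi A k : ℂ))) *
      Complex.exp (Complex.I * (θ : ℂ)) = 0 := by
    rw [show _ = (0 : ℂ) from h, zero_mul]
  rw [Finset.sum_mul] at hmul
  have him := congrArg Complex.im hmul
  rw [Complex.im_sum, Complex.zero_im] at him
  rw [← him]
  refine Finset.sum_congr rfl fun k _ => ?_
  rw [mul_assoc, ← Complex.exp_add, ← mul_add, ← Complex.ofReal_add, Complex.im_ofReal_mul,
    mul_comm Complex.I, Complex.exp_ofReal_mul_I_im]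

theorem sin_sub_add_sin_sub_sin (a b : ℝ) :
    Real.sin (a - b) + Real.sin b - Real.sin a =
      4 * Real.sin ((a - b) / 2) * Real.sin (a / 2) * Real.sin (b / 2) := by
  obtain ⟨x, rfl⟩ : ∃ x, a = 2 * x := ⟨a / 2, by ring⟩
  obtain ⟨y, rfl⟩ : ∃ y, b = 2 * y := ⟨b / 2, by ring⟩
  rw [show 2 * x - 2 * y = 2 * (x - y) by ring]
  simp only [mul_div_cancel_left₀ _ (two_ne_zero' ℝ), Real.sin_two_mul, Real.sin_sub,
    Real.cos_sub]
  have hx := Real.sin_sq_add_cos_sq x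
  have hy := Real.sin_sq_add_cos_sq y
  linear_combination (2 * Real.sin x * Real.cos x) * hy - (2 * Real.sin y * Real.cos y) * hx

/-- For `0 < a, b < π`, the sine relation forces `a = b`. -/
theorem eq_of_sin_sub_add_sin_eq_sin {a b : ℝ} (ha : 0 < a) (ha' : a < Real.pi) (hb : 0 < b)
    (hb' : b < Real.pi) (h : Real.sin (a - b) + Real.sin b - Real.sin a = 0) : a = b := by
  have hsa : Real.sin (a / 2) ≠ 0 := (Real.sin_pos_of_pos_of_lt_pi (by linarith) (by linarith)).ne'
  have hsb : Real.sin (b / 2) ≠ 0 := (Real.sin_pos_of_pos_of_lt_pi (by linarith) (by linarith)).ne'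
  rw [sin_sub_add_sin_sub_sin] at h
  have hd : Real.sin ((a - b) / 2) = 0 := by simpa [hsa, hsb] using h
  have := (Real.sin_eq_zero_iff_of_lt_of_lt (by linarith) (by linarith)).1 hd
  linarith

theorem stmt11 (ℓ A : Fin 6 → ℝ)
    (hlen : ∀ k, 0 < ℓ k)
    (hang_pos : ∀ i, 0 < A i) (hang_lt : ∀ i, A i < 2 * Real.pi)
    (hang_sum : A 0 + A 1 + A 2 + A 3 + A 4 + A 5 = 4 * Real.pi)
    (hclose : HexClosure ℓ A)
    (h01 : ℓ 0 = ℓ 1) (h02 : ℓ 0 = ℓ 2) (h04 : ℓ 0 = ℓ 4) (h05 : ℓ 0 = ℓ 5)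
    (hA24 : A 2 = A 4) (hA35 : A 3 = A 5)
    (h024 : A 0 + A 2 + A 4 = 2 * Real.pi)
    (h135 : A 1 + A 3 + A 5 = 2 * Real.pi) :
    A 2 = A 3 ∧ (A 2 = A 3 ∧ A 3 = A 4 ∧ A 4 = A 5) ∧ A 0 = A 1 := by
  have hA0 := hang_pos 0
  have hA1 := hang_pos 1
  have hrel : Real.sin (A 2 - A 3) + Real.sin (A 3) - Real.sin (A 2) = 0 := by
    have hsum := hclose.sum_mul_sin_add (A 2 - A 3)
    have e0 : hexPhi A 0 + (A 2 - A 3) = A 2 - A 3 := by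
      simp [hexPhi, Finset.sum_filter, Fin.sum_univ_six]
    have e1 : hexPhi A 1 + (A 2 - A 3) = A 2 + A 3 - Real.pi := by
      simp [hexPhi, Finset.sum_filter, Fin.sum_univ_six]
      linarith
    have e2 : hexPhi A 2 + (A 2 - A 3) = A 3 := by
      simp [hexPhi, Finset.sum_filter, Fin.sum_univ_six]
      linarith
    have e3 : hexPhi A 3 + (A 2 - A 3) = Real.pi := by
      simp [hexPhi, Finset.sum_filter, Fin.sum_univ_six]
      linarith
    have e4 : hexPhi A 4 + (A 2 - A 3) = 2 * Real.pi - A 2 := by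
      simp [hexPhi, Finset.sum_filter, Fin.sum_univ_six]
      linarith
    have e5 : hexPhi A 5 + (A 2 - A 3) = Real.pi - (A 2 + A 3) + 2 * Real.pi := by
      simp [hexPhi, Finset.sum_filter, Fin.sum_univ_six]
      linarith
    rw [Fin.sum_univ_six, e0, e1, e2, e3, e4, e5, ← h01, ← h02, ← h04, ← h05,
      Real.sin_sub_pi, Real.sin_pi, Real.sin_two_pi_sub, Real.sin_add_two_pi,
      Real.sin_pi_sub] at hsum
    refine (mul_eq_zero.1 ?_).resolve_left (hlen 0).ne'
    linear_combination hsum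
  have h23 : A 2 = A 3 := eq_of_sin_sub_add_sin_eq_sin (hang_pos 2) (by linarith) (hang_pos 3)
    (by linarith) hrel
  exact ⟨h23, ⟨h23, by linarith, by linarith⟩, by linarith⟩
end

section
/- Let a hexagon (encoded as in the context) satisfy ℓ₃ = ℓ₄ = ℓ₅ = 1, ℓ₀ = ℓ₁ = b, ℓ₂ = a, A₁ = A₄ = A₅ = 2π/3, A₀ = β and A₃ = α (so A₂ = 2π − α − β by the angle sum), and assume sin(π/6 + α + β) ≠ 0. Then a = 2·cos β / sin(π/6 + α + β) and b = 2·cos(π/6 + α) / (√3 · sin(π/6 + α + β)). -/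
open Real

/-- The two real components of the closure equation. -/
lemma HexClosure.re_im {ℓ A : Fin 6 → ℝ} (h : HexClosure ℓ A) :
    ∑ k, ℓ k * cos (hexPhi A k) = 0 ∧ ∑ k, ℓ k * sin (hexPhi A k) = 0 := by
  have h' : ∑ k, (ℓ k : ℂ) * Complex.exp ((hexPhi A k : ℂ) * Complex.I) = 0 := by
    simpa only [HexClosure, mul_comm Complex.I] using h
  constructor
  · simpa only [Complex.re_sum, Complex.re_ofReal_mul, Complex.exp_ofReal_mul_I_re,
      Complex.zero_re] using congrArg Complex.re h'
  · simpa only [Complex.im_sum, Complex.im_ofReal_mul, Complex.exp_ofReal_mul_I_im,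
      Complex.zero_im] using congrArg Complex.im h'

lemma hexPhi_zero (A : Fin 6 → ℝ) : hexPhi A 0 = 0 := by
  simp [hexPhi, Finset.sum_filter, Fin.sum_univ_six]

lemma hexPhi_succ (A : Fin 6 → ℝ) (k : Fin 5) :
    hexPhi A k.succ = hexPhi A k.castSucc + (π - A k.succ) := by
  fin_cases k <;> simp [hexPhi, Finset.sum_filter, Fin.sum_univ_six] <;> ring

theorem stmt12 (ℓ A : Fin 6 → ℝ) (a b α β : ℝ)
    (hlen : ∀ k, 0 < ℓ k)
    (hang_pos : ∀ i, 0 < A i) (hang_lt : ∀ i, A i < 2 * Real.pi)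
    (hang_sum : A 0 + A 1 + A 2 + A 3 + A 4 + A 5 = 4 * Real.pi)
    (hclose : HexClosure ℓ A)
    (hl3 : ℓ 3 = 1) (hl4 : ℓ 4 = 1) (hl5 : ℓ 5 = 1)
    (hl0 : ℓ 0 = b) (hl1 : ℓ 1 = b) (hl2 : ℓ 2 = a)
    (hA1 : A 1 = 2 * Real.pi / 3) (hA4 : A 4 = 2 * Real.pi / 3)
    (hA5 : A 5 = 2 * Real.pi / 3)
    (hA0 : A 0 = β) (hA3 : A 3 = α)
    (hsin : Real.sin (Real.pi / 6 + α + β) ≠ 0) :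
    a = 2 * Real.cos β / Real.sin (Real.pi / 6 + α + β) ∧
    b = 2 * Real.cos (Real.pi / 6 + α) /
          (Real.sqrt 3 * Real.sin (Real.pi / 6 + α + β)) := by
  have h1 : hexPhi A 1 = π / 3 := by
    linarith [hexPhi_zero A, show hexPhi A 1 = hexPhi A 0 + (π - A 1) from hexPhi_succ A 0]
  have h2 : hexPhi A 2 = α + β - 2 * π / 3 := by
    linarith [show hexPhi A 2 = hexPhi A 1 + (π - A 2) from hexPhi_succ A 1]
  have h3 : hexPhi A 3 = β + π / 3 := by
    linarith [show hexPhi A 3 = hexPhi A 2 + (π - A 3) from hexPhi_succ A 2]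
  have h4 : hexPhi A 4 = β + (π - π / 3) := by
    linarith [show hexPhi A 4 = hexPhi A 3 + (π - A 4) from hexPhi_succ A 3]
  have h5 : hexPhi A 5 = β + π := by
    linarith [show hexPhi A 5 = hexPhi A 4 + (π - A 5) from hexPhi_succ A 4]
  obtain ⟨hre, him⟩ := hclose.re_im
  simp only [Fin.sum_univ_six, hexPhi_zero, h1, h2, h3, h4, h5, hl0, hl1, hl2, hl3, hl4, hl5,
    cos_zero, sin_zero, cos_add β, sin_add β, cos_pi_sub, sin_pi_sub, cos_pi, sin_pi,
    cos_pi_div_three, sin_pi_div_three] at hre him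
  have hs3 : √3 ^ 2 = 3 := sq_sqrt (by norm_num)
  generalize hθ : α + β - 2 * π / 3 = θ at hre him
  have hS : sin (π / 6 + α + β) = (1 / 2) * cos θ - (√3 / 2) * sin θ := by
    rw [show π / 6 + α + β = θ + (π - π / 6) by rw [← hθ]; ring, sin_add, cos_pi_sub, sin_pi_sub,
      cos_pi_div_six, sin_pi_div_six]
    ring
  have hC : cos (π / 6 + α) =
      -(√3 / 2) * (cos θ * cos β + sin θ * sin β) -
        (1 / 2) * (sin θ * cos β - cos θ * sin β) := by
    rw [show π / 6 + α = (θ - β) + (π - π / 6) by rw [← hθ]; ring, cos_add, cos_pi_sub, sin_pi_sub,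
      cos_pi_div_six, sin_pi_div_six, cos_sub, sin_sub]
    ring
  constructor
  · rw [eq_div_iff hsin, hS]
    linear_combination (1 / 2) * hre - (√3 / 2) * him + (b / 4 + cos β / 2) * hs3
  · rw [eq_div_iff (mul_ne_zero (by positivity) hsin), hS, hC]
    linear_combination cos θ * him - sin θ * hre - b * sin θ / 2 * hs3
end

section
/- Let a hexagon (encoded as in the context) satisfy ℓ₁ = ℓ₃ = ℓ₄ = ℓ₅ = 1, ℓ₀ = a, ℓ₂ = b, A₁ = A₃ = A₅ = 2π/3, A₀ = A₂ = α and A₄ = 2π − 2α, and assume sin(α − π/3) ≠ 0. Then a = (4√3·sin²α − 2·sin α − √3) / (2·sin(α − π/3)) and b = (4·sin α − √3) / (2·sin(α − π/3)). -/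
/-- The closure equation, written with cosines and sines of the direction angles. -/
lemma HexClosure.cos_sin_sum_eq_zero {ℓ A : Fin 6 → ℝ} (h : HexClosure ℓ A) :
    ∑ k, ℓ k * Real.cos (hexPhi A k) = 0 ∧ ∑ k, ℓ k * Real.sin (hexPhi A k) = 0 := by
  unfold HexClosure at h
  constructor
  · simpa [mul_comm Complex.I, Complex.exp_ofReal_mul_I_re] using congrArg Complex.re h
  · simpa [mul_comm Complex.I, Complex.exp_ofReal_mul_I_im] using congrArg Complex.im h

theorem stmt13 (ℓ A : Fin 6 → ℝ) (a b α : ℝ)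
    (hlen : ∀ k, 0 < ℓ k)
    (hang_pos : ∀ i, 0 < A i) (hang_lt : ∀ i, A i < 2 * Real.pi)
    (hang_sum : A 0 + A 1 + A 2 + A 3 + A 4 + A 5 = 4 * Real.pi)
    (hclose : HexClosure ℓ A)
    (hl1 : ℓ 1 = 1) (hl3 : ℓ 3 = 1) (hl4 : ℓ 4 = 1) (hl5 : ℓ 5 = 1)
    (hl0 : ℓ 0 = a) (hl2 : ℓ 2 = b)
    (hA1 : A 1 = 2 * Real.pi / 3) (hA3 : A 3 = 2 * Real.pi / 3)
    (hA5 : A 5 = 2 * Real.pi / 3)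
    (hA0 : A 0 = α) (hA2 : A 2 = α) (hA4 : A 4 = 2 * Real.pi - 2 * α)
    (hsin : Real.sin (α - Real.pi / 3) ≠ 0) :
    a = (4 * Real.sqrt 3 * Real.sin α ^ 2 - 2 * Real.sin α - Real.sqrt 3) /
          (2 * Real.sin (α - Real.pi / 3)) ∧
    b = (4 * Real.sin α - Real.sqrt 3) / (2 * Real.sin (α - Real.pi / 3)) := by
  obtain ⟨hre, him⟩ := hclose.cos_sin_sum_eq_zero
  have hphi0 : hexPhi A 0 = 0 := by
    simp [hexPhi, Finset.sum_filter, Fin.sum_univ_six]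
  have hphi1 : hexPhi A 1 = Real.pi / 3 := by
    simp [hexPhi, Finset.sum_filter, Fin.sum_univ_six, hA1]
    ring
  have hphi2 : hexPhi A 2 = Real.pi - (α - Real.pi / 3) := by
    simp [hexPhi, Finset.sum_filter, Fin.sum_univ_six, hA1, hA2]
    ring
  have hphi3 : hexPhi A 3 = 2 * Real.pi - (α + Real.pi / 3) := by
    simp [hexPhi, Finset.sum_filter, Fin.sum_univ_six, hA1, hA2, hA3]
    ring
  have hphi4 : hexPhi A 4 = Real.pi - (Real.pi / 3 - α) := by
    simp [hexPhi, Finset.sum_filter, Fin.sum_univ_six, hA1, hA2, hA3, hA4]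
    ring
  have hphi5 : hexPhi A 5 = α + Real.pi := by
    simp [hexPhi, Finset.sum_filter, Fin.sum_univ_six, hA1, hA2, hA3, hA4, hA5]
    ring
  simp only [Fin.sum_univ_six, hphi0, hphi1, hphi2, hphi3, hphi4, hphi5, hl0, hl1, hl2, hl3, hl4,
    hl5, Real.cos_pi, Real.sin_pi, Real.cos_two_pi, Real.sin_two_pi, Real.cos_add, Real.sin_add, Real.cos_sub, Real.sin_sub,
    Real.cos_pi_div_three, Real.sin_pi_div_three, Real.cos_zero, Real.sin_zero] at hre him
  rw [Real.sin_sub, Real.cos_pi_div_three, Real.sin_pi_div_three] at hsin ⊢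
  have hsqrt : Real.sqrt 3 ^ 2 = 3 := Real.sq_sqrt (by norm_num)
  have hcos : Real.cos α ^ 2 = 1 - Real.sin α ^ 2 := Real.cos_sq' α
  set s := Real.sin α
  set c := Real.cos α
  set r := Real.sqrt 3
  have hden : 2 * (s * (1 / 2) - c * (r / 2)) ≠ 0 := mul_ne_zero two_ne_zero hsin
  have hb : b * (2 * (s * (1 / 2) - c * (r / 2))) = 4 * s - r := by
    linear_combination 2 * him
  refine ⟨(eq_div_iff hden).2 ?_, (eq_div_iff hden).2 hb⟩
  linear_combination (s - c * r) * hre + (c * (1 / 2) + s * (r / 2)) * hb +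
    (-(c * s) - s / 2) * hsqrt - r * hcos
end

section
/- Let a hexagon (encoded as in the context) satisfy ℓ₁ = ℓ₃ = ℓ₄ = ℓ₅ = 1, ℓ₀ = ℓ₂ = a, A₄ = A₅ = 2π/3, A₀ = α, A₁ = β, A₂ = 4π/3 − β and A₃ = 4π/3 − α. Then 2·exp(I·(α − 2π/3)) − a = exp(I·(2π/3 − β)) in ℂ; consequently π/2 ≤ α ≤ 5π/6, 4·cos²(α − 2π/3) ≥ 3, and either a = 2·cos(α − 2π/3) + √(4·cos²(α − 2π/3) − 3) or a = 2·cos(α − 2π/3) − √(4·cos²(α − 2π/3) − 3). -/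
/-- Closure of a hexagon with `φ = 0, π - β, 2π/3, π/3 + α, 2π/3 + α, π + α` and edge lengths
`a, 1, a, 1, 1, 1`, divided by `exp (iπ/3)`. -/
theorem two_mul_exp_sub_eq_exp_of_closure {a α β : ℝ}
    (h : (a : ℂ) + Complex.exp (Complex.I * ((Real.pi - β : ℝ) : ℂ)) +
        a * Complex.exp (Complex.I * ((2 * Real.pi / 3 : ℝ) : ℂ)) +
        Complex.exp (Complex.I * ((Real.pi / 3 + α : ℝ) : ℂ)) +
        Complex.exp (Complex.I * ((2 * Real.pi / 3 + α : ℝ) : ℂ)) +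
        Complex.exp (Complex.I * ((Real.pi + α : ℝ) : ℂ)) = 0) :
    2 * Complex.exp (Complex.I * ((α - 2 * Real.pi / 3 : ℝ) : ℂ)) - (a : ℂ) =
      Complex.exp (Complex.I * ((2 * Real.pi / 3 - β : ℝ) : ℂ)) := by
  obtain ⟨w, hw⟩ : ∃ w, w = Complex.exp (Complex.I * ((Real.pi / 3 : ℝ) : ℂ)) := ⟨_, rfl⟩
  have hw2 : w ^ 2 - w + 1 = 0 := by
    have h3 : ((√3 : ℝ) : ℂ) ^ 2 = 3 := by
      rw [← Complex.ofReal_pow, Real.sq_sqrt (by norm_num)]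
      norm_num
    rw [hw, mul_comm, Complex.exp_mul_I, ← Complex.ofReal_cos, ← Complex.ofReal_sin,
      Real.cos_pi_div_three, Real.sin_pi_div_three]
    push_cast
    linear_combination (1 / 4 : ℂ) * Complex.I ^ 2 * h3 + (3 / 4 : ℂ) * Complex.I_sq
  have key (n : ℕ) (x y : ℝ) (hy : y = n * (Real.pi / 3) + x) :
      Complex.exp (Complex.I * (y : ℂ)) = w ^ n * Complex.exp (Complex.I * (x : ℂ)) := by
    rw [hw, ← Complex.exp_nat_mul, ← Complex.exp_add, hy]
    push_cast
    ring_nf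
  have hα := key 2 (α - 2 * Real.pi / 3) α (by push_cast; ring)
  rw [key 3 (-β) (Real.pi - β) (by push_cast; ring),
    key 2 0 (2 * Real.pi / 3) (by push_cast; ring),
    key 1 α (Real.pi / 3 + α) (by push_cast; ring),
    key 2 α (2 * Real.pi / 3 + α) (by push_cast; ring),
    key 3 α (Real.pi + α) (by push_cast; ring)] at h
  rw [key 2 (-β) (2 * Real.pi / 3 - β) (by push_cast; ring)]
  simp only [Complex.ofReal_zero, mul_zero, Complex.exp_zero] at h
  generalize Complex.exp (Complex.I * (α : ℂ)) = E at h hα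
  generalize Complex.exp (Complex.I * ((-β : ℝ) : ℂ)) = B at h ⊢
  generalize Complex.exp (Complex.I * ((α - 2 * Real.pi / 3 : ℝ) : ℂ)) = F at hα ⊢
  linear_combination (w - 1) * h - (a * w + B * w ^ 2 + E * (w ^ 2 + w)) * hw2 +
    2 * w * hα + 2 * F * (w + 1) * hw2

/-- The law of cosines for a triangle with sides `2`, `a`, `1`. -/
theorem sq_sub_two_mul_cos_of_exp_eq {a θ ψ : ℝ}
    (h : 2 * Complex.exp (Complex.I * (θ : ℂ)) - (a : ℂ) = Complex.exp (Complex.I * (ψ : ℂ))) :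
    (a - 2 * Real.cos θ) ^ 2 = 4 * Real.cos θ ^ 2 - 3 := by
  rw [mul_comm Complex.I, mul_comm Complex.I] at h
  have hre := congrArg Complex.re h
  have him := congrArg Complex.im h
  simp [Complex.exp_ofReal_mul_I_re, Complex.exp_ofReal_mul_I_im] at hre him
  have hψ := Real.sin_sq_add_cos_sq ψ
  rw [← hre, ← him] at hψ
  linear_combination hψ - 4 * Real.sin_sq_add_cos_sq θ

theorem abs_le_pi_div_six_of_three_le_four_mul_cos_sq {θ : ℝ} (hθ : |θ| ≤ Real.pi)
    (hpos : 0 < Real.cos θ) (h : 3 ≤ 4 * Real.cos θ ^ 2) : |θ| ≤ Real.pi / 6 := by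
  by_contra! hlt
  have hcos := Real.cos_lt_cos_of_nonneg_of_le_pi (by positivity) hθ hlt
  rw [Real.cos_abs, Real.cos_pi_div_six] at hcos
  nlinarith [Real.sq_sqrt (show (0 : ℝ) ≤ 3 by norm_num)]

theorem stmt15 (ℓ A : Fin 6 → ℝ) (a α β : ℝ)
    (hlen : ∀ k, 0 < ℓ k)
    (hang_pos : ∀ i, 0 < A i) (hang_lt : ∀ i, A i < 2 * Real.pi)
    (hang_sum : A 0 + A 1 + A 2 + A 3 + A 4 + A 5 = 4 * Real.pi)
    (hclose : HexClosure ℓ A)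
    (hl1 : ℓ 1 = 1) (hl3 : ℓ 3 = 1) (hl4 : ℓ 4 = 1) (hl5 : ℓ 5 = 1)
    (hl0 : ℓ 0 = a) (hl2 : ℓ 2 = a)
    (hA4 : A 4 = 2 * Real.pi / 3) (hA5 : A 5 = 2 * Real.pi / 3)
    (hA0 : A 0 = α) (hA1 : A 1 = β)
    (hA2 : A 2 = 4 * Real.pi / 3 - β) (hA3 : A 3 = 4 * Real.pi / 3 - α) :
    2 * Complex.exp (Complex.I * ((α - 2 * Real.pi / 3 : ℝ) : ℂ)) - (a : ℂ) =
        Complex.exp (Complex.I * ((2 * Real.pi / 3 - β : ℝ) : ℂ)) ∧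
    (Real.pi / 2 ≤ α ∧ α ≤ 5 * Real.pi / 6) ∧
    4 * Real.cos (α - 2 * Real.pi / 3) ^ 2 ≥ 3 ∧
    (a = 2 * Real.cos (α - 2 * Real.pi / 3) +
          Real.sqrt (4 * Real.cos (α - 2 * Real.pi / 3) ^ 2 - 3) ∨
      a = 2 * Real.cos (α - 2 * Real.pi / 3) -
          Real.sqrt (4 * Real.cos (α - 2 * Real.pi / 3) ^ 2 - 3)) := by
  have hpi := Real.pi_pos
  have ha : 0 < a := hl0 ▸ hlen 0
  have hexp := two_mul_exp_sub_eq_exp_of_closure (a := a) (α := α) (β := β) <| by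
    have h0 : hexPhi A 0 = 0 := by
      simp [hexPhi, Finset.sum_filter, Fin.sum_univ_six]
    have h1 : hexPhi A 1 = Real.pi - β := by
      simp [hexPhi, Finset.sum_filter, Fin.sum_univ_six, hA1]
    have h2 : hexPhi A 2 = 2 * Real.pi / 3 := by
      simp [hexPhi, Finset.sum_filter, Fin.sum_univ_six, hA1, hA2]
      ring
    have h3 : hexPhi A 3 = Real.pi / 3 + α := by
      simp [hexPhi, Finset.sum_filter, Fin.sum_univ_six, hA1, hA2, hA3]
      ring
    have h4 : hexPhi A 4 = 2 * Real.pi / 3 + α := by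
      simp [hexPhi, Finset.sum_filter, Fin.sum_univ_six, hA1, hA2, hA3, hA4]
      ring
    have h5 : hexPhi A 5 = Real.pi + α := by
      simp [hexPhi, Finset.sum_filter, Fin.sum_univ_six, hA1, hA2, hA3, hA4, hA5]
      ring
    simpa only [HexClosure, Fin.sum_univ_six, h0, h1, h2, h3, h4, h5, hl0, hl1, hl2, hl3, hl4,
      hl5, Complex.ofReal_zero, Complex.ofReal_one, mul_zero, Complex.exp_zero, mul_one,
      one_mul] using hclose
  have hsq := sq_sub_two_mul_cos_of_exp_eq hexp
  have hcos : 3 ≤ 4 * Real.cos (α - 2 * Real.pi / 3) ^ 2 := by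
    linarith [sq_nonneg (a - 2 * Real.cos (α - 2 * Real.pi / 3))]
  have hcos_pos : 0 < Real.cos (α - 2 * Real.pi / 3) := by
    by_contra! hneg
    nlinarith
  have hα_pos : 0 < α := hA0 ▸ hang_pos 0
  have hα_lt : 0 < 4 * Real.pi / 3 - α := hA3 ▸ hang_pos 3
  have hθ := abs_le.1 <| abs_le_pi_div_six_of_three_le_four_mul_cos_sq
    (abs_le.2 ⟨by linarith, by linarith⟩) hcos_pos hcos
  refine ⟨hexp, ⟨by linarith [hθ.1], by linarith [hθ.2]⟩, hcos, ?_⟩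
  rw [← Real.sq_sqrt (sub_nonneg.2 hcos), sq_eq_sq_iff_eq_or_eq_neg] at hsq
  exact hsq.imp (fun h => by linarith) fun h => by linarith
end

section
/- For every real number α, sin 4α − sin 5α − sin 3α − 2·sin α = −2·(2·cos α + 1)·(4·cos³α − 4·cos²α + 1)·sin α. Moreover, if a and α are real numbers with a > 0 and π/2 < α < 3π/4 such that a + e^{i(3π−4α)} + e^{i(4π−5α)} + e^{i(−π+3α)} + e^{i(2π−α)} + e^{i(π+α)} = 0 in ℂ, then either cos α = −1/2 and a = 1, or 4·cos³α − 4·cos²α + 1 = 0 and a = 12·cos²α − 6·cos α − 3. -/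
theorem cos_four_mul (x : ℝ) :
    Real.cos (4 * x) = 8 * Real.cos x ^ 4 - 8 * Real.cos x ^ 2 + 1 := by
  rw [show 4 * x = 2 * (2 * x) by ring, Real.cos_two_mul, Real.cos_two_mul]
  ring

theorem sin_four_mul (x : ℝ) :
    Real.sin (4 * x) = Real.sin x * (8 * Real.cos x ^ 3 - 4 * Real.cos x) := by
  rw [show 4 * x = 2 * (2 * x) by ring, Real.sin_two_mul, Real.sin_two_mul, Real.cos_two_mul]
  ring

theorem cos_five_mul (x : ℝ) :
    Real.cos (5 * x) = 16 * Real.cos x ^ 5 - 20 * Real.cos x ^ 3 + 5 * Real.cos x := by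
  rw [show 5 * x = 4 * x + x by ring, Real.cos_add, cos_four_mul, sin_four_mul]
  linear_combination
    (-(8 * Real.cos x ^ 3 - 4 * Real.cos x)) * Real.sin_sq_add_cos_sq x

theorem sin_five_mul (x : ℝ) :
    Real.sin (5 * x) = Real.sin x * (16 * Real.cos x ^ 4 - 12 * Real.cos x ^ 2 + 1) := by
  rw [show 5 * x = 4 * x + x by ring, Real.sin_add, cos_four_mul, sin_four_mul]
  ring

theorem stmt16 :
    (∀ α : ℝ, Real.sin (4 * α) - Real.sin (5 * α) - Real.sin (3 * α) -
        2 * Real.sin α =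
      -2 * (2 * Real.cos α + 1) *
        (4 * Real.cos α ^ 3 - 4 * Real.cos α ^ 2 + 1) * Real.sin α) ∧
    (∀ a α : ℝ, 0 < a → Real.pi / 2 < α → α < 3 * Real.pi / 4 →
      (a : ℂ) + Complex.exp (Complex.I * ((3 * Real.pi - 4 * α : ℝ) : ℂ)) +
          Complex.exp (Complex.I * ((4 * Real.pi - 5 * α : ℝ) : ℂ)) +
          Complex.exp (Complex.I * ((-Real.pi + 3 * α : ℝ) : ℂ)) +
          Complex.exp (Complex.I * ((2 * Real.pi - α : ℝ) : ℂ)) +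
          Complex.exp (Complex.I * ((Real.pi + α : ℝ) : ℂ)) = 0 →
      (Real.cos α = -(1 / 2) ∧ a = 1) ∨
      (4 * Real.cos α ^ 3 - 4 * Real.cos α ^ 2 + 1 = 0 ∧
        a = 12 * Real.cos α ^ 2 - 6 * Real.cos α - 3)) := by
  constructor
  · intro α
    rw [sin_four_mul, sin_five_mul, Real.sin_three_mul]
    linear_combination (4 * Real.sin α) * Real.sin_sq_add_cos_sq α
  · intro a α _ hα hα' h
    have hs : 0 < Real.sin α :=
      Real.sin_pos_of_pos_of_lt_pi (by linarith [Real.pi_pos]) (by linarith [Real.pi_pos])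
    have hre := congrArg Complex.re h
    have him := congrArg Complex.im h
    simp only [mul_comm Complex.I, Complex.add_re, Complex.add_im, Complex.ofReal_re,
      Complex.ofReal_im, Complex.exp_ofReal_mul_I_re, Complex.exp_ofReal_mul_I_im,
      Complex.zero_re, Complex.zero_im] at hre him
    rw [show 3 * Real.pi - 4 * α = Real.pi - 4 * α + 2 * Real.pi by ring,
      show 4 * Real.pi - 5 * α = -(5 * α) + 2 * Real.pi + 2 * Real.pi by ring,
      show -Real.pi + 3 * α = 3 * α - Real.pi by ring,
      show Real.pi + α = α + Real.pi by ring] at hre him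
    simp only [Real.cos_add_two_pi, Real.sin_add_two_pi, Real.cos_pi_sub, Real.sin_pi_sub,
      Real.cos_neg, Real.sin_neg, Real.cos_sub_pi, Real.sin_sub_pi, Real.cos_two_pi_sub,
      Real.sin_two_pi_sub, Real.cos_add_pi, Real.sin_add_pi] at hre him
    rw [cos_four_mul, cos_five_mul, Real.cos_three_mul] at hre
    rw [sin_four_mul, sin_five_mul, Real.sin_three_mul] at him
    have hprod : (2 * Real.cos α + 1) * (4 * Real.cos α ^ 3 - 4 * Real.cos α ^ 2 + 1) = 0 := by
      apply mul_right_cancel₀ hs.ne'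
      linear_combination (-1 / 2) * him + 2 * Real.sin α * Real.sin_sq_add_cos_sq α
    rcases mul_eq_zero.mp hprod with hc | hc
    · left
      have hc' : Real.cos α = -(1 / 2) := by linarith
      refine ⟨hc', ?_⟩
      rw [hc'] at hre
      linarith
    · right
      refine ⟨hc, ?_⟩
      linear_combination hre + (-4 * Real.cos α ^ 2 - 2 * Real.cos α + 4) * hc
end

section
/- Let α be a real number with π/2 < α < 7π/9. If 1 + e^{i(π−α)} + e^{i(−8π/3+5α)} + e^{i(π/3+α)} + e^{i(8π/3−2α)} + e^{i(5π/3)} = 0 in ℂ, then α = 2π/3. -/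
open Real in
/-- The half-angle factorization of the imaginary part of the rotated exponential sum. -/
theorem sin_sum_eq_mul (t : ℝ) :
    sin (π / 2 - 2 * t) + sin (5 * π / 6 + 10 * t) + sin (7 * π / 6 + 2 * t) +
        sin (3 * π / 2 - 4 * t) =
      2 * sin (3 * t) * (sin t - 2 * cos (3 * t) * cos (π / 6 - 4 * t)) := by
  have e1 : sin (5 * π / 6 + 10 * t) = sin (π / 6 - 10 * t) := by
    rw [← sin_pi_sub]; ring_nf
  have e2 : sin (7 * π / 6 + 2 * t) = -sin (π / 6 + 2 * t) := by
    rw [← sin_add_pi]; ring_nf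
  have e3 : sin (3 * π / 2 - 4 * t) = -cos (4 * t) := by
    rw [← sin_pi_div_two_sub, ← sin_add_pi]; ring_nf
  have d1 := cos_sub_cos (2 * t) (4 * t)
  have d2 := sin_sub_sin (π / 6 - 10 * t) (π / 6 + 2 * t)
  rw [show (2 * t + 4 * t) / 2 = 3 * t by ring, show (2 * t - 4 * t) / 2 = -t by ring,
    sin_neg] at d1
  rw [show (π / 6 - 10 * t - (π / 6 + 2 * t)) / 2 = -(2 * (3 * t)) by ring,
    show (π / 6 - 10 * t + (π / 6 + 2 * t)) / 2 = π / 6 - 4 * t by ring, sin_neg,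
    sin_two_mul] at d2
  rw [sin_pi_div_two_sub, e1, e2, e3]
  linear_combination d1 + d2

open Real in
theorem sin_lt_two_mul_cos_mul_cos {t : ℝ} (h1 : -(π / 12) < t) (h2 : t < π / 18) :
    sin t < 2 * cos (3 * t) * cos (π / 6 - 4 * t) := by
  have hpi := pi_pos
  rcases le_or_gt t 0 with ht | ht
  · have hs : sin t ≤ 0 := sin_nonpos_of_nonpos_of_neg_pi_le ht (by linarith)
    have hc : 0 < cos (3 * t) := cos_pos_of_mem_Ioo ⟨by linarith, by linarith⟩
    have hd : 0 < cos (π / 6 - 4 * t) := cos_pos_of_mem_Ioo ⟨by linarith, by linarith⟩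
    have := mul_pos hc hd
    linarith
  · have half_lt_cos {x : ℝ} (hx : |x| < π / 3) : 1 / 2 < cos x := by
      rw [← cos_pi_div_three, ← cos_abs x]
      exact cos_lt_cos_of_nonneg_of_le_pi (abs_nonneg x) (by linarith) hx
    have hs : sin t < 1 / 2 := by
      rw [← sin_pi_div_six]
      exact sin_lt_sin_of_lt_of_le_pi_div_two (by linarith) (by linarith) (by linarith)
    have hc : 1 / 2 < cos (3 * t) := half_lt_cos (abs_lt.2 ⟨by linarith, by linarith⟩)
    have hd : 1 / 2 < cos (π / 6 - 4 * t) := half_lt_cos (abs_lt.2 ⟨by linarith, by linarith⟩)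
    nlinarith

/-- The imaginary part of `exp (i x) * exp (i y)`. -/
theorem im_exp_mul_exp (x y : ℝ) :
    (Complex.exp (Complex.I * (x : ℂ)) * Complex.exp (Complex.I * (y : ℂ))).im =
      Real.sin (x + y) := by
  rw [← Complex.exp_add, ← mul_add, ← Complex.ofReal_add, mul_comm,
    Complex.exp_ofReal_mul_I_im]


theorem stmt19 (α : ℝ) (h1 : Real.pi / 2 < α) (h2 : α < 7 * Real.pi / 9)
    (heq : (1 : ℂ) + Complex.exp (Complex.I * ((Real.pi - α : ℝ) : ℂ)) +
        Complex.exp (Complex.I * ((-(8 * Real.pi / 3) + 5 * α : ℝ) : ℂ)) +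
        Complex.exp (Complex.I * ((Real.pi / 3 + α : ℝ) : ℂ)) +
        Complex.exp (Complex.I * ((8 * Real.pi / 3 - 2 * α : ℝ) : ℂ)) +
        Complex.exp (Complex.I * ((5 * Real.pi / 3 : ℝ) : ℂ)) = 0) :
    α = 2 * Real.pi / 3 := by
  obtain ⟨t, rfl⟩ : ∃ t, α = 2 * Real.pi / 3 + 2 * t :=
    ⟨(α - 2 * Real.pi / 3) / 2, by ring⟩
  have him := congrArg
    (fun z => (z * Complex.exp (Complex.I * ((Real.pi / 6 : ℝ) : ℂ))).im) heq
  have h0 := im_exp_mul_exp 0 (Real.pi / 6)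
  rw [Complex.ofReal_zero, mul_zero, Complex.exp_zero] at h0
  simp only [add_mul, Complex.add_im, im_exp_mul_exp, h0, zero_mul, Complex.zero_im] at him
  have h6 : Real.sin (5 * Real.pi / 3 + Real.pi / 6) = -Real.sin (0 + Real.pi / 6) := by
    rw [← Real.sin_neg, ← Real.sin_add_two_pi (-(0 + Real.pi / 6))]
    ring_nf
  have hprod := sin_sum_eq_mul t
  rw [show Real.pi / 2 - 2 * t = Real.pi - (2 * Real.pi / 3 + 2 * t) + Real.pi / 6 by ring,
    show 5 * Real.pi / 6 + 10 * t =
      -(8 * Real.pi / 3) + 5 * (2 * Real.pi / 3 + 2 * t) + Real.pi / 6 by ring,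
    show 7 * Real.pi / 6 + 2 * t =
      Real.pi / 3 + (2 * Real.pi / 3 + 2 * t) + Real.pi / 6 by ring,
    show 3 * Real.pi / 2 - 4 * t =
      8 * Real.pi / 3 - 2 * (2 * Real.pi / 3 + 2 * t) + Real.pi / 6 by ring] at hprod
  have hzero : 2 * Real.sin (3 * t) *
      (Real.sin t - 2 * Real.cos (3 * t) * Real.cos (Real.pi / 6 - 4 * t)) = 0 := by
    linarith
  have hpi := Real.pi_pos
  have hlt := sin_lt_two_mul_cos_mul_cos (t := t) (by linarith) (by linarith)
  have hsin : Real.sin (3 * t) = 0 := by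
    simpa using (mul_eq_zero.1 hzero).resolve_right (sub_neg.2 hlt).ne
  have ht := (Real.sin_eq_zero_iff_of_lt_of_lt (by linarith) (by linarith)).1 hsin
  linarith
end
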